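/- arXiv:2103.06440 — 5 statements merged into one kernel-verified Lean document; each statement's English description precedes it below -/
import Mathlib

section
/- Let n be a natural number and K : Fin n → ℝ with K j > 0 for all j. Define F : (Fin n → ℝ) → ℝ by F(x) = ∑_{j} (x j - √((x j)² - 4·K j))/2. Then F is strictly convex on the convex set S = {x : Fin n → ℝ | ∀ j, x j > 2√(K j)}. -/
/-- A sum of strictly convex functions of the separate coordinates is strictly convex on the
product of their domains. -/
theorem strictConvexOn_pi_sum {ι : Type*} [Fintype ι] {s : ι → Set ℝ} {f : ι → ℝ → ℝ}
    (hf : ∀ j, StrictConvexOn ℝ (s j) (f j)) :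
    StrictConvexOn ℝ {x : ι → ℝ | ∀ j, x j ∈ s j} (fun x => ∑ j, f j (x j)) := by
  refine ⟨fun x hx y hy a b ha hb hab j => (hf j).1 (hx j) (hy j) ha hb hab, ?_⟩
  intro x hx y hy hxy a b ha hb hab
  obtain ⟨i, hi⟩ := Function.ne_iff.mp hxy
  simp only [smul_eq_mul, Finset.mul_sum, ← Finset.sum_add_distrib]
  exact Finset.sum_lt_sum
    (fun j _ => (hf j).convexOn.2 (hx j) (hy j) ha.le hb.le hab)
    ⟨i, Finset.mem_univ i, (hf i).2 (hx i) (hy i) hi ha hb hab⟩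

/-- The upper branch of the hyperbola `x ^ 2 - y ^ 2 = 4 * K` is strictly concave. -/
theorem strictConcaveOn_sqrt_sq_sub {K : ℝ} (hK : 0 < K) :
    StrictConcaveOn ℝ (Set.Ioi (2 * √K)) (fun x => √(x ^ 2 - 4 * K)) := by
  have dom : ∀ z ∈ Set.Ioi (2 * √K), 0 < z ∧ 0 < z ^ 2 - 4 * K := by
    intro z hz
    have hz' : 2 * √K < z := hz
    have h0 := Real.sqrt_nonneg K
    have h1 := Real.sq_sqrt hK.le
    exact ⟨by linarith, by nlinarith⟩
  refine ⟨convex_Ioi _, fun x hx y hy hxy a b ha hb hab => ?_⟩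
  obtain ⟨hx0, hx1⟩ := dom x hx
  obtain ⟨hy0, hy1⟩ := dom y hy
  simp only [smul_eq_mul]
  have hs := Real.sq_sqrt hx1.le
  have ht := Real.sq_sqrt hy1.le
  set s := √(x ^ 2 - 4 * K)
  set t := √(y ^ 2 - 4 * K)
  have hxy4 : 0 < x * y - 4 * K := by
    nlinarith [mul_pos (mul_pos hx0 hx0) hy1, mul_pos hx0 hy0]
  have hst : s * t < x * y - 4 * K := by
    refine lt_of_pow_lt_pow_left₀ 2 hxy4.le ?_
    rw [mul_pow, hs, ht]
    nlinarith [mul_pos hK (sq_pos_of_ne_zero (sub_ne_zero.mpr hxy))]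
  apply Real.lt_sqrt_of_sq_lt
  obtain rfl : b = 1 - a := by linarith
  linear_combination 2 * mul_pos (mul_pos ha hb) (sub_pos.mpr hst) + a ^ 2 * hs + (1 - a) ^ 2 * ht

/-- The delay of a single task is strictly convex in the payment `x`. -/
theorem strictConvexOn_delay {K : ℝ} (hK : 0 < K) :
    StrictConvexOn ℝ (Set.Ioi (2 * √K)) (fun x => (x - √(x ^ 2 - 4 * K)) / 2) := by
  refine ⟨convex_Ioi _, fun x hx y hy hxy a b ha hb hab => ?_⟩
  have h := (strictConcaveOn_sqrt_sq_sub hK).2 hx hy hxy ha hb hab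
  simp only [smul_eq_mul] at h ⊢
  linarith

/-- The total delay objective `F(x) = ∑_j (x j - √((x j)² - 4 K j))/2` is strictly
convex on the convex set `{x | ∀ j, x j > 2√(K j)}`. -/
theorem total_delay_strictConvexOn (n : ℕ) (K : Fin n → ℝ) (hK : ∀ j, 0 < K j) :
    StrictConvexOn ℝ {x : Fin n → ℝ | ∀ j, x j > 2 * Real.sqrt (K j)}
      (fun x : Fin n → ℝ =>
        ∑ j, (x j - Real.sqrt ((x j) ^ 2 - 4 * K j)) / 2) := by
  exact strictConvexOn_pi_sum fun j => strictConvexOn_delay (hK j)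
end

section
/- Let c, ĉ, d > 0 and let b be a real number with b ≥ c + (c·ĉ)/(c + d). Then (b + d)² ≥ 4·c·ĉ, and the wage w = (b - d + √((b+d)² - 4·c·ĉ))/2 satisfies w ≥ c; that is, under this budget condition the server's wage is at least its cost of honest execution. -/
/-- If the budget satisfies `b ≥ c + c·chat/(c + d)` then the discriminant is
nonnegative and the wage `w = (b - d + √((b+d)² - 4c·chat))/2` is at least the
server's cost `c` of honest execution. -/
theorem wage_ge_cost (c chat d b : ℝ) (hc : 0 < c) (hchat : 0 < chat) (hd : 0 < d)
    (hb : b ≥ c + c * chat / (c + d)) :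
    (b + d) ^ 2 ≥ 4 * c * chat ∧
    (b - d + Real.sqrt ((b + d) ^ 2 - 4 * c * chat)) / 2 ≥ c := by
  have hcost : c * chat ≤ (b - c) * (c + d) :=
    (div_le_iff₀ (add_pos hc hd)).1 (by linarith)
  have hsq : (2 * c + d - b) ^ 2 ≤ (b + d) ^ 2 - 4 * c * chat := by linarith
  refine ⟨by linarith [sq_nonneg (2 * c + d - b)], ?_⟩
  linarith [Real.le_sqrt_of_sq_le hsq]
end

section
/- Let c, ĉ > 0 and let b be a fixed real number. Then the function d ↦ (b - d + √((b + d)² - 4·c·ĉ))/2 is strictly increasing on the set {d : ℝ | b + d ≥ 2√(c·ĉ)}; that is, for a fixed budget, the server's wage from a task strictly increases with the deposit assigned to the task. -/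
/-- For a fixed budget `b`, the server's wage
`d ↦ (b - d + √((b + d)² - 4c·chat))/2` strictly increases with the deposit `d`
on the set `{d | b + d ≥ 2√(c·chat)}`. -/
theorem wage_strictMonoOn_deposit (c chat b : ℝ) (hc : 0 < c) (hchat : 0 < chat) :
    StrictMonoOn
      (fun d : ℝ => (b - d + Real.sqrt ((b + d) ^ 2 - 4 * c * chat)) / 2)
      {d : ℝ | b + d ≥ 2 * Real.sqrt (c * chat)} := by
  intro x hx y _ hxy
  simp only [Set.mem_ofPred_eq, ge_iff_le] at hx ⊢
  have hk : 0 < c * chat := mul_pos hc hchat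
  have hr : 0 < √(c * chat) := Real.sqrt_pos.2 hk
  have hr2 : √(c * chat) ^ 2 = c * chat := Real.sq_sqrt hk.le
  have hnonneg : 0 ≤ (b + x) ^ 2 - 4 * c * chat := by nlinarith
  have hs_lt : √((b + x) ^ 2 - 4 * c * chat) < b + x := by
    rw [Real.sqrt_lt' (by linarith)]
    linarith
  have hs2 := Real.sq_sqrt hnonneg
  have key : √((b + x) ^ 2 - 4 * c * chat) + (y - x) < √((b + y) ^ 2 - 4 * c * chat) := by
    apply Real.lt_sqrt_of_sq_lt
    nlinarith [mul_pos (sub_pos.2 hxy) (sub_pos.2 hs_lt)]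
  linarith
end

section
/- Let n be a natural number, a : Fin n → ℝ, s a real number, and for each j let f_j : ℝ → ℝ be differentiable and convex on [a j, ∞). Let S = {x : Fin n → ℝ | ∑_j x j = s ∧ ∀ j, x j ≥ a j}. Suppose x* ∈ S minimizes ∑_j f_j(x* j) over S. Then for every index j with x* j > a j and every index k, the derivative of f_j at x* j is at most the derivative of f_k at x* k. -/
/-- The set of allocations with total `s` and lower bounds `a` is convex. -/
theorem convex_allocations {ι : Type*} [Fintype ι] (a : ι → ℝ) (s : ℝ) :
    Convex ℝ {x : ι → ℝ | (∑ i, x i = s) ∧ ∀ i, x i ≥ a i} := by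
  intro x hx y hy p q hp hq hpq
  refine ⟨?_, fun i => ?_⟩
  · simp only [Pi.add_apply, Pi.smul_apply, smul_eq_mul, Finset.sum_add_distrib,
      ← Finset.mul_sum, hx.1, hy.1]
    rw [← add_mul, hpq, one_mul]
  · exact convex_Ici (a i) (hx.2 i) (hy.2 i) hp hq hpq

/-- Moving the excess of coordinate `j` over its lower bound to coordinate `k` gives another
allocation with the same total and the same lower bounds. -/
theorem add_transfer_mem_allocations {ι : Type*} [Fintype ι] [DecidableEq ι] {a : ι → ℝ} {s : ℝ}
    {x : ι → ℝ} (hx : (∑ i, x i = s) ∧ ∀ i, x i ≥ a i) (j k : ι) :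
    x + (x j - a j) • (Pi.single k (1 : ℝ) - Pi.single j 1) ∈
      {x : ι → ℝ | (∑ i, x i = s) ∧ ∀ i, x i ≥ a i} := by
  refine ⟨?_, fun i => ?_⟩
  · simp [Finset.sum_add_distrib, ← Finset.mul_sum, hx.1]
  · have hi := hx.2 i
    have hj := hx.2 j
    simp only [Pi.add_apply, Pi.smul_apply, Pi.sub_apply, Pi.single_apply, smul_eq_mul]
    split_ifs <;> subst_vars <;> linarith

/-- The derivative of a separable function `x ↦ ∑ i, f i (x i)`. -/
theorem hasFDerivAt_sum_apply {ι : Type*} [Fintype ι] {f : ι → ℝ → ℝ} {f' x : ι → ℝ}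
    (h : ∀ i, HasDerivAt (f i) (f' i) (x i)) :
    HasFDerivAt (fun y : ι → ℝ => ∑ i, f i (y i))
      (∑ i, f' i • (ContinuousLinearMap.proj i : (ι → ℝ) →L[ℝ] ℝ)) x :=
  HasFDerivAt.fun_sum fun i _ => (h i).comp_hasFDerivAt x (hasFDerivAt_apply i x)


/-- First-order exchange condition for the greedy allocation: if `x*` minimizes
`∑_j f_j (x j)` over allocations with fixed total `s` and lower bounds `a j`,
where each `f_j` is differentiable (with derivative `f' j`) and convex on
`[a j, ∞)`, then for every coordinate `j` with `x* j > a j` and every coordinate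
`k`, the derivative of `f_j` at `x* j` is at most the derivative of `f_k` at `x* k`. -/
theorem greedy_first_order_condition (n : ℕ) (a : Fin n → ℝ) (s : ℝ)
    (f : Fin n → ℝ → ℝ) (f' : Fin n → ℝ → ℝ)
    (hderiv : ∀ j, ∀ x ∈ Set.Ici (a j), HasDerivAt (f j) (f' j x) x)
    (hconv : ∀ j, ConvexOn ℝ (Set.Ici (a j)) (f j))
    (S : Set (Fin n → ℝ))
    (hS : S = {x : Fin n → ℝ | (∑ j, x j = s) ∧ ∀ j, x j ≥ a j})
    (xstar : Fin n → ℝ) (hxS : xstar ∈ S)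
    (hmin : IsMinOn (fun x : Fin n → ℝ => ∑ j, f j (x j)) S xstar) :
    ∀ j k, xstar j > a j → f' j (xstar j) ≤ f' k (xstar k) := by
  subst hS
  intro j k hj
  have hnonneg := hmin.localize.hasFDerivWithinAt_nonneg
    (hasFDerivAt_sum_apply fun i => hderiv i _ (hxS.2 i)).hasFDerivWithinAt
    (mem_posTangentConeAt_of_segment_subset
      ((convex_allocations a s).segment_subset hxS (add_transfer_mem_allocations hxS j k)))
  rw [map_smul, smul_eq_mul] at hnonneg
  have hdir := nonneg_of_mul_nonneg_right hnonneg (sub_pos.mpr hj)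
  simpa [Pi.single_apply, mul_sub, Finset.sum_sub_distrib] using hdir
end

section
/- Let n be a natural number and β, γ, s : Fin n → ℝ with s j ≥ β j + γ j for all j. Let B, D be real numbers with B ≥ ∑_j β j, D ≥ ∑_j γ j, and B + D = ∑_j s j. Then there exist b, d : Fin n → ℝ such that for all j: b j + d j = s j, b j ≥ β j, d j ≥ γ j, and moreover ∑_j b j = B and ∑_j d j = D. -/
/-- Splitting step: per-task sums `s j ≥ β j + γ j` with totals `B ≥ ∑ β`,
`D ≥ ∑ γ` and `B + D = ∑ s` can always be split into per-task budgets `b j ≥ β j`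
and deposits `d j ≥ γ j` with `b j + d j = s j`, `∑ b = B` and `∑ d = D`. -/
theorem split_sums_into_budget_and_deposit (n : ℕ) (β γ s : Fin n → ℝ)
    (hs : ∀ j, s j ≥ β j + γ j) (B D : ℝ)
    (hB : B ≥ ∑ j, β j) (hD : D ≥ ∑ j, γ j) (hBD : B + D = ∑ j, s j) :
    ∃ b d : Fin n → ℝ,
      (∀ j, b j + d j = s j) ∧ (∀ j, b j ≥ β j) ∧ (∀ j, d j ≥ γ j) ∧
      (∑ j, b j = B) ∧ (∑ j, d j = D) := by
  -- Distribute the surplus `B - ∑ β` proportionally to the slacks `s j - β j - γ j`.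
  have slack_nonneg : ∀ j, 0 ≤ s j - β j - γ j := fun j => by linarith [hs j]
  have sum_slack : ∑ j, (s j - β j - γ j) = B + D - ∑ j, β j - ∑ j, γ j := by
    rw [Finset.sum_sub_distrib, Finset.sum_sub_distrib, hBD]
  obtain ⟨t, ht0, ht1, ht⟩ : ∃ t : ℝ, 0 ≤ t ∧ t ≤ 1 ∧
      t * ∑ j, (s j - β j - γ j) = B - ∑ j, β j := by
    have hE : 0 ≤ ∑ j, (s j - β j - γ j) := Finset.sum_nonneg fun j _ => slack_nonneg j
    refine ⟨(B - ∑ j, β j) / ∑ j, (s j - β j - γ j), div_nonneg (by linarith) hE,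
      div_le_one_of_le₀ (by linarith) hE, div_mul_cancel_of_imp fun h => by linarith⟩
  have sum_budget : ∑ j, (β j + t * (s j - β j - γ j)) = B := by
    rw [Finset.sum_add_distrib, ← Finset.mul_sum, ht]
    ring
  refine ⟨fun j => β j + t * (s j - β j - γ j), fun j => s j - (β j + t * (s j - β j - γ j)),
    fun j => by ring, fun j => ?_, fun j => ?_, sum_budget, ?_⟩
  · linarith [mul_nonneg ht0 (slack_nonneg j)]
  · linarith [mul_le_of_le_one_left (slack_nonneg j) ht1]
  · rw [Finset.sum_sub_distrib, sum_budget]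
    linarith
end
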